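/- Let d ≥ 1, let Σ be a d×d symmetric matrix with entries in {0,1} such that every neighborhood D_i = {j ∈ {1,…,d} : Σ_{ij} = 1} is nonempty, let π be a permutation of {1,…,d}, and set l_i = max{|π(i) − π(j)| : j ∈ D_i}. Let m be an integer with 1 ≤ m and 2m ≤ d, and suppose that for every pair of distinct indices i, j with |π(i) − π(j)| ≤ m the inequalities |l_i − l_j| ≤ |π(i) − π(j)| ≤ l_i + l_j hold. Define (as a real number) δ_m = (1/(d·m)) · Σ_{(i,j) : |π(i)−π(j)| ≤ m} | |π(i) − π(j)| − |D_i Δ D_j|/2 |, the sum ranging over all ordered pairs (i,j) ∈ {1,…,d}² with |π(i) − π(j)| ≤ m. Then δ_m ≤ (4/d)·Σ_{i=1}^d l_i + (2/d)·Σ_{i=1}^d (1 − |D_i|) − (1/d)·( Σ_{i : π(i) ≤ m} ((m + 1 − π(i))/m)·(2·l_i + 1 − |D_i|) + Σ_{i : π(i) ≥ d − m + 1} ((m − d + π(i))/m)·(2·l_i + 1 − |D_i|) ). -/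

import Mathlib

open scoped symmDiff

/-- The neighborhood `D_i = {j : Σ_{ij} = 1}` of the row index `i`. -/
def nbhd {d : ℕ} (S : Matrix (Fin d) (Fin d) ℕ) (i : Fin d) : Finset (Fin d) :=
  Finset.univ.filter fun j => S i j = 1

/-- The 1-based position of `i` under the permutation `π`, as an integer. -/
def posIdx {d : ℕ} (π : Equiv.Perm (Fin d)) (i : Fin d) : ℤ := (π i).val + 1

/-- The half-width `l_i^{(π)} = max_{j ∈ D_i} |π(i) - π(j)|` of `D_i` under `π`. -/
def halfWidth {d : ℕ} (S : Matrix (Fin d) (Fin d) ℕ) (π : Equiv.Perm (Fin d)) (i : Fin d) : ℕ :=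
  (nbhd S i).sup fun j => (posIdx π i - posIdx π j).natAbs

theorem Finset.card_symmDiff_le_add_card_sdiff {α : Type*} [DecidableEq α] (A B V W : Finset α)
    (hA : A ⊆ V) (hB : B ⊆ W) :
    (A ∆ B).card ≤ (V ∆ W).card + (V \ A).card + (W \ B).card ∧
      (V ∆ W).card ≤ (A ∆ B).card + (V \ A).card + (W \ B).card := by
  constructor
  · refine (Finset.card_le_card (t := V ∆ W ∪ V \ A ∪ W \ B) ?_).trans
      ((Finset.card_union_le _ _).trans (Nat.add_le_add_right (Finset.card_union_le _ _) _))
    intro x hx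
    have := @hA x
    have := @hB x
    simp only [Finset.mem_union, Finset.mem_symmDiff, Finset.mem_sdiff] at *
    tauto
  · refine (Finset.card_le_card (t := A ∆ B ∪ V \ A ∪ W \ B) ?_).trans
      ((Finset.card_union_le _ _).trans (Nat.add_le_add_right (Finset.card_union_le _ _) _))
    intro x hx
    have := @hA x
    have := @hB x
    simp only [Finset.mem_union, Finset.mem_symmDiff, Finset.mem_sdiff] at *
    tauto

theorem Finset.card_symmDiff_add_two_mul_card_inter {α : Type*} [DecidableEq α]
    (V W : Finset α) : (V ∆ W).card + 2 * (V ∩ W).card = V.card + W.card := by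
  have h : (V ∆ W).card = (V \ W).card + (W \ V).card :=
    Finset.card_union_of_disjoint disjoint_sdiff_sdiff
  have h1 := Finset.card_sdiff_add_card_inter V W
  have h2 := Finset.card_sdiff_add_card_inter W V
  rw [Finset.inter_comm W V] at h2
  omega

/-- Two overlapping, non-nested integer intervals with centres `p`, `q` and radii `k`, `l` have a
symmetric difference of size twice the distance of the centres. -/
theorem card_symmDiff_Icc_centered (p q : ℤ) (k l : ℕ) (h1 : |(k : ℤ) - l| ≤ |p - q|)
    (h2 : |p - q| ≤ (k : ℤ) + l) :
    (((Finset.Icc (p - k) (p + k)) ∆ (Finset.Icc (q - l) (q + l))).card : ℤ) = 2 * |p - q| := by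
  have h := Finset.card_symmDiff_add_two_mul_card_inter
    (Finset.Icc (p - k) (p + k)) (Finset.Icc (q - l) (q + l))
  have hI : Finset.Icc (p - k) (p + k) ∩ Finset.Icc (q - l) (q + l) =
      Finset.Icc (max (p - k) (q - l)) (min (p + k) (q + l)) := by
    ext x
    simp only [Finset.mem_inter, Finset.mem_Icc]
    omega
  rw [hI] at h
  simp only [Int.card_Icc] at h
  have h3 := abs_le.1 h1
  rcases abs_cases (p - q) with hc | hc <;> rw [hc.1] at h2 h3 ⊢
  · rw [show (p - k) ⊔ (q - l) = p - k by apply sup_eq_left.2; omega,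
      show (p + k) ⊓ (q + l) = q + l by apply inf_eq_right.2; omega] at h
    omega
  · rw [show (p - k) ⊔ (q - l) = q - l by apply sup_eq_right.2; omega,
      show (p + k) ⊓ (q + l) = p + k by apply inf_eq_left.2; omega] at h
    omega

theorem posIdx_injective {d : ℕ} (π : Equiv.Perm (Fin d)) : Function.Injective (posIdx π) := by
  intro i j h
  apply π.injective
  apply Fin.ext
  unfold posIdx at h
  omega

theorem posIdx_mem_Icc {d : ℕ} (π : Equiv.Perm (Fin d)) (i : Fin d) :
    posIdx π i ∈ Finset.Icc (1 : ℤ) d := by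
  have := (π i).isLt
  rw [Finset.mem_Icc]
  unfold posIdx
  omega

theorem image_nbhd_subset_Icc {d : ℕ} (S : Matrix (Fin d) (Fin d) ℕ) (π : Equiv.Perm (Fin d))
    (i : Fin d) : (nbhd S i).image (posIdx π) ⊆
      Finset.Icc (posIdx π i - halfWidth S π i) (posIdx π i + halfWidth S π i) := by
  intro x hx
  obtain ⟨j, hj, rfl⟩ := Finset.mem_image.1 hx
  have h : (posIdx π i - posIdx π j).natAbs ≤ halfWidth S π i :=
    Finset.le_sup (f := fun j => (posIdx π i - posIdx π j).natAbs) hj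
  rw [Finset.mem_Icc]
  omega

theorem card_Icc_sdiff_image_nbhd {d : ℕ} (S : Matrix (Fin d) (Fin d) ℕ)
    (π : Equiv.Perm (Fin d)) (i : Fin d) :
    ((Finset.Icc (posIdx π i - halfWidth S π i) (posIdx π i + halfWidth S π i) \
      (nbhd S i).image (posIdx π)).card : ℝ) =
      2 * (halfWidth S π i : ℝ) + 1 - ((nbhd S i).card : ℝ) := by
  have h := Finset.card_sdiff_add_card_eq_card (image_nbhd_subset_Icc S π i)
  rw [Finset.card_image_of_injective _ (posIdx_injective π), Int.card_Icc] at h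
  have h' : (Finset.Icc (posIdx π i - halfWidth S π i) (posIdx π i + halfWidth S π i) \
      (nbhd S i).image (posIdx π)).card + (nbhd S i).card = 2 * halfWidth S π i + 1 := by
    omega
  have h'' := congrArg (Nat.cast : ℕ → ℝ) h'
  push_cast at h''
  linarith

theorem abs_dist_sub_card_symmDiff_le {d : ℕ} (S : Matrix (Fin d) (Fin d) ℕ)
    (π : Equiv.Perm (Fin d)) (i j : Fin d)
    (h1 : |(halfWidth S π i : ℤ) - (halfWidth S π j : ℤ)| ≤ |posIdx π i - posIdx π j|)
    (h2 : |posIdx π i - posIdx π j| ≤ (halfWidth S π i : ℤ) + (halfWidth S π j : ℤ)) :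
    abs (|(posIdx π i : ℝ) - (posIdx π j : ℝ)| - ((nbhd S i ∆ nbhd S j).card : ℝ) / 2) ≤
      ((2 * (halfWidth S π i : ℝ) + 1 - ((nbhd S i).card : ℝ)) +
        (2 * (halfWidth S π j : ℝ) + 1 - ((nbhd S j).card : ℝ))) / 2 := by
  have hc := card_symmDiff_Icc_centered _ _ _ _ h1 h2
  obtain ⟨ha, hb⟩ := Finset.card_symmDiff_le_add_card_sdiff _ _ _ _
    (image_nbhd_subset_Icc S π i) (image_nbhd_subset_Icc S π j)
  rw [← Finset.image_symmDiff _ _ (posIdx_injective π),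
    Finset.card_image_of_injective _ (posIdx_injective π)] at ha hb
  have hc' := congrArg (Int.cast : ℤ → ℝ) hc
  have ha' := (Nat.cast_le (α := ℝ)).2 ha
  have hb' := (Nat.cast_le (α := ℝ)).2 hb
  push_cast at hc' ha' hb'
  rw [card_Icc_sdiff_image_nbhd, card_Icc_sdiff_image_nbhd, hc'] at ha' hb'
  rw [abs_le]
  constructor <;> linarith

theorem card_near_le {d : ℕ} (m : ℕ) (π : Equiv.Perm (Fin d)) (i : Fin d) :
    ((Finset.univ.filter fun j => |posIdx π i - posIdx π j| ≤ (m : ℤ) ∧ i ≠ j).card : ℤ) ≤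
      2 * m - (if posIdx π i ≤ (m : ℤ) then (m : ℤ) + 1 - posIdx π i else 0) -
        (if (d : ℤ) - m + 1 ≤ posIdx π i then (m : ℤ) - d + posIdx π i else 0) := by
  have hi := Finset.mem_Icc.1 (posIdx_mem_Icc π i)
  have hsub : (Finset.univ.filter fun j => |posIdx π i - posIdx π j| ≤ (m : ℤ) ∧ i ≠ j).image
      (posIdx π) ⊆
      (Finset.Icc (max 1 (posIdx π i - m)) (min d (posIdx π i + m))).erase (posIdx π i) := by
    intro x hx
    obtain ⟨j, hj, rfl⟩ := Finset.mem_image.1 hx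
    obtain ⟨hj1, hj2⟩ := (Finset.mem_filter.1 hj).2
    have hj3 := Finset.mem_Icc.1 (posIdx_mem_Icc π j)
    have hj4 := abs_le.1 hj1
    refine Finset.mem_erase.2 ⟨fun h => hj2 (posIdx_injective π h.symm), Finset.mem_Icc.2 ?_⟩
    omega
  have h := Finset.card_le_card hsub
  rw [Finset.card_image_of_injective _ (posIdx_injective π),
    Finset.card_erase_of_mem (Finset.mem_Icc.2 (by omega)), Int.card_Icc] at h
  split_ifs <;> omega

/-- Upper bound on `δ_m(G_π, A_Σ)` when the two-sided inequalities hold for all pairs of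
distinct indices at permuted distance at most `m`. -/
theorem delta_m_upper_bound (d m : ℕ) (hd : 1 ≤ d) (S : Matrix (Fin d) (Fin d) ℕ)
    (h01 : ∀ i j, S i j = 0 ∨ S i j = 1) (hsym : ∀ i j, S i j = S j i)
    (hne : ∀ i, (nbhd S i).Nonempty) (π : Equiv.Perm (Fin d))
    (hm1 : 1 ≤ m) (hm2 : 2 * m ≤ d)
    (hineq : ∀ i j : Fin d, i ≠ j → |posIdx π i - posIdx π j| ≤ (m : ℤ) →
      |(halfWidth S π i : ℤ) - (halfWidth S π j : ℤ)| ≤ |posIdx π i - posIdx π j| ∧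
      |posIdx π i - posIdx π j| ≤ (halfWidth S π i : ℤ) + (halfWidth S π j : ℤ)) :
    (1 / ((d : ℝ) * m)) *
        ∑ p ∈ (Finset.univ : Finset (Fin d × Fin d)).filter
            (fun p => |posIdx π p.1 - posIdx π p.2| ≤ (m : ℤ)),
          abs (|(posIdx π p.1 : ℝ) - (posIdx π p.2 : ℝ)| -
            ((nbhd S p.1 ∆ nbhd S p.2).card : ℝ) / 2) ≤
      (4 / (d : ℝ)) * ∑ i : Fin d, (halfWidth S π i : ℝ) +
      (2 / (d : ℝ)) * ∑ i : Fin d, (1 - ((nbhd S i).card : ℝ)) -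
      (1 / (d : ℝ)) *
        ((∑ i ∈ Finset.univ.filter (fun i : Fin d => posIdx π i ≤ (m : ℤ)),
            (((m : ℝ) + 1 - (posIdx π i : ℝ)) / (m : ℝ)) *
              (2 * (halfWidth S π i : ℝ) + 1 - ((nbhd S i).card : ℝ))) +
         (∑ i ∈ Finset.univ.filter (fun i : Fin d => (d : ℤ) - m + 1 ≤ posIdx π i),
            (((m : ℝ) - (d : ℝ) + (posIdx π i : ℝ)) / (m : ℝ)) *
              (2 * (halfWidth S π i : ℝ) + 1 - ((nbhd S i).card : ℝ)))) := by
  set a : Fin d → ℝ := fun i => 2 * (halfWidth S π i : ℝ) + 1 - ((nbhd S i).card : ℝ) with ha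
  have ha0 : ∀ i, 0 ≤ a i := fun i => by
    simp only [ha, ← card_Icc_sdiff_image_nbhd]
    positivity
  have hd0 : (0 : ℝ) < d := by exact_mod_cast hd
  have hm0 : (0 : ℝ) < m := by exact_mod_cast hm1
  have hpairs : ∑ p ∈ (Finset.univ : Finset (Fin d × Fin d)).filter
      (fun p => |posIdx π p.1 - posIdx π p.2| ≤ (m : ℤ)),
      abs (|(posIdx π p.1 : ℝ) - (posIdx π p.2 : ℝ)| -
        ((nbhd S p.1 ∆ nbhd S p.2).card : ℝ) / 2) ≤
      ∑ i, ∑ j, if |posIdx π i - posIdx π j| ≤ (m : ℤ) ∧ i ≠ j then (a i + a j) / 2 else 0 := by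
    rw [Finset.sum_filter, Fintype.sum_prod_type]
    refine Finset.sum_le_sum fun i _ => Finset.sum_le_sum fun j _ => ?_
    by_cases hij : i = j
    · subst hij
      simp
    · by_cases hn : |posIdx π i - posIdx π j| ≤ (m : ℤ)
      · obtain ⟨h1, h2⟩ := hineq i j hij hn
        simpa [hn, hij] using abs_dist_sub_card_symmDiff_le S π i j h1 h2
      · simp [hn]
  have hsymm : (∑ i, ∑ j, if |posIdx π i - posIdx π j| ≤ (m : ℤ) ∧ i ≠ j
      then (a i + a j) / 2 else 0) =
      ∑ i, ((Finset.univ.filter fun j =>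
        |posIdx π i - posIdx π j| ≤ (m : ℤ) ∧ i ≠ j).card : ℝ) * a i := by
    have hswap : (∑ i, ∑ j, if |posIdx π i - posIdx π j| ≤ (m : ℤ) ∧ i ≠ j
        then a j / 2 else 0) =
        ∑ i, ∑ j, if |posIdx π i - posIdx π j| ≤ (m : ℤ) ∧ i ≠ j then a i / 2 else 0 := by
      rw [Finset.sum_comm]
      simp only [abs_sub_comm, ne_comm]
    have hsplit : ∀ i j, (if |posIdx π i - posIdx π j| ≤ (m : ℤ) ∧ i ≠ j
        then (a i + a j) / 2 else 0) =
        (if |posIdx π i - posIdx π j| ≤ (m : ℤ) ∧ i ≠ j then a i / 2 else 0) +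
        (if |posIdx π i - posIdx π j| ≤ (m : ℤ) ∧ i ≠ j then a j / 2 else 0) := by
      intro i j
      split_ifs <;> ring
    simp only [hsplit, Finset.sum_add_distrib]
    rw [hswap, ← Finset.sum_add_distrib]
    refine Finset.sum_congr rfl fun i _ => ?_
    rw [← Finset.sum_filter, Finset.sum_const, nsmul_eq_mul]
    ring
  have hcount : ∀ i, ((Finset.univ.filter fun j =>
      |posIdx π i - posIdx π j| ≤ (m : ℤ) ∧ i ≠ j).card : ℝ) * a i ≤
      m * (2 * a i -
        ((if posIdx π i ≤ (m : ℤ) then ((m : ℝ) + 1 - posIdx π i) / m * a i else 0) +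
        (if (d : ℤ) - m + 1 ≤ posIdx π i then ((m : ℝ) - d + posIdx π i) / m * a i else 0))) := by
    intro i
    have h := (Int.cast_le (R := ℝ)).2 (card_near_le m π i)
    push_cast at h
    refine (mul_le_mul_of_nonneg_right h (ha0 i)).trans (le_of_eq ?_)
    split_ifs <;> field_simp <;> ring
  have htotal := (hpairs.trans hsymm.le).trans (Finset.sum_le_sum fun i _ => hcount i)
  rw [← Finset.mul_sum, Finset.sum_sub_distrib, Finset.sum_add_distrib, ← Finset.mul_sum,
    ← Finset.sum_filter, ← Finset.sum_filter] at htotal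
  have hsum : ∑ i, a i = 2 * ∑ i, (halfWidth S π i : ℝ) + ∑ i, (1 - ((nbhd S i).card : ℝ)) := by
    rw [Finset.mul_sum, ← Finset.sum_add_distrib]
    exact Finset.sum_congr rfl fun i _ => by simp only [ha]; ring
  refine (mul_le_mul_of_nonneg_left htotal (by positivity)).trans (le_of_eq ?_)
  rw [hsum]
  field_simp
  ring
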